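/- For positive integers m and n, one has ζ({2m}^n) = (−1)^{n(m+1)} (2π)^{2mn} · Σ_{a₁+2a₂+⋯+na_n=n, aᵢ≥0} Π_{k=1}^{n} (1/a_k!) · ( B_{2km} / (2k·(2km)!) )^{a_k}, and ζ⋆({2m}^n) = (−1)^{mn} (2π)^{2mn} · Σ_{a₁+2a₂+⋯+na_n=n, aᵢ≥0} Π_{k=1}^{n} ((−1)^{a_k}/a_k!) · ( B_{2km} / (2k·(2km)!) )^{a_k}, where B_j denotes the j-th Bernoulli number. -/

import Mathlib

open Real Finset

/-- Multiple zeta value with real exponents `a i`, summed over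
`1 ≤ k₁ < k₂ < ⋯ < k_r`. -/
noncomputable def mzv {r : ℕ} (a : Fin r → ℝ) : ℝ :=
  ∑' f : {f : Fin r → ℕ // (∀ i, 1 ≤ f i) ∧ StrictMono f},
    ∏ i, ((f.1 i : ℝ)) ^ (-(a i))

/-- Multiple zeta star value with real exponents `a i`, summed over
`1 ≤ k₁ ≤ k₂ ≤ ⋯ ≤ k_r`. -/
noncomputable def mzsv {r : ℕ} (a : Fin r → ℝ) : ℝ :=
  ∑' f : {f : Fin r → ℕ // (∀ i, 1 ≤ f i) ∧ Monotone f},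
    ∏ i, ((f.1 i : ℝ)) ^ (-(a i))

open Filter Topology

/-- Sum of `∏ i, x (f i)` over strictly increasing `f : Fin n → {1, …, N}`. -/
noncomputable def strictMonoSum (x : ℕ → ℝ) (N n : ℕ) : ℝ :=
  ∑ f ∈ (Fintype.piFinset fun _ : Fin n => Finset.Icc 1 N) with StrictMono f, ∏ i, x (f i)

/-- Sum of `∏ i, x (f i)` over weakly increasing `f : Fin n → {1, …, N}`. -/
noncomputable def monotoneSum (x : ℕ → ℝ) (N n : ℕ) : ℝ :=
  ∑ f ∈ (Fintype.piFinset fun _ : Fin n => Finset.Icc 1 N) with Monotone f, ∏ i, x (f i)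

lemma strictMono_snoc_iff {n : ℕ} (f : Fin n → ℕ) (a : ℕ) :
    StrictMono (Fin.snoc f a : Fin (n + 1) → ℕ) ↔ StrictMono f ∧ ∀ i, f i < a := by
  constructor
  · refine fun h => ⟨fun i j hij => ?_, fun i => ?_⟩
    · simpa using h (Fin.castSucc_lt_castSucc_iff.2 hij)
    · simpa using h (Fin.castSucc_lt_last i)
  · rintro ⟨hf, ha⟩ i j
    induction i using Fin.lastCases with
    | last => exact fun h => absurd h (Fin.le_last j).not_gt
    | cast i =>
      induction j using Fin.lastCases with
      | last => simpa using ha i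
      | cast j => simpa using @hf i j

lemma monotone_snoc_iff {n : ℕ} (f : Fin n → ℕ) (a : ℕ) :
    Monotone (Fin.snoc f a : Fin (n + 1) → ℕ) ↔ Monotone f ∧ ∀ i, f i ≤ a := by
  constructor
  · refine fun h => ⟨fun i j hij => ?_, fun i => ?_⟩
    · simpa using h (Fin.castSucc_le_castSucc_iff.2 hij)
    · simpa using h (Fin.castSucc_lt_last i).le
  · rintro ⟨hf, ha⟩ i j
    induction j using Fin.lastCases with
    | last =>
      induction i using Fin.lastCases with
      | last => simp
      | cast i => simpa using fun _ => ha i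
    | cast j =>
      induction i using Fin.lastCases with
      | last => exact fun h => absurd h (Fin.castSucc_lt_last j).not_ge
      | cast i => simpa using @hf i j

lemma strictMonoSum_zero_right (x : ℕ → ℝ) (N : ℕ) : strictMonoSum x N 0 = 1 := by
  simp [strictMonoSum, Finset.filter_true_of_mem, Subsingleton.strictMono]

lemma monotoneSum_zero_right (x : ℕ → ℝ) (N : ℕ) : monotoneSum x N 0 = 1 := by
  simp [monotoneSum, Finset.filter_true_of_mem, Subsingleton.monotone]

lemma strictMonoSum_zero_succ (x : ℕ → ℝ) (n : ℕ) : strictMonoSum x 0 (n + 1) = 0 := by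
  simp [strictMonoSum]

lemma monotoneSum_zero_succ (x : ℕ → ℝ) (n : ℕ) : monotoneSum x 0 (n + 1) = 0 := by
  simp [monotoneSum]

lemma strictMonoSum_succ_succ (x : ℕ → ℝ) (N n : ℕ) :
    strictMonoSum x (N + 1) (n + 1) =
      strictMonoSum x N (n + 1) + x (N + 1) * strictMonoSum x N n := by
  unfold strictMonoSum
  rw [← Finset.sum_filter_add_sum_filter_not _ (fun f => f (Fin.last n) = N + 1), add_comm]
  congr 1
  · refine Finset.sum_congr ?_ fun _ _ => rfl
    ext f
    simp only [Finset.mem_filter, Fintype.mem_piFinset, Finset.mem_Icc]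
    constructor
    · rintro ⟨⟨h, hf⟩, hl⟩
      refine ⟨fun i => ⟨(h i).1, ?_⟩, hf⟩
      have := hf.monotone (Fin.le_last i)
      have := h (Fin.last n)
      omega
    · rintro ⟨h, hf⟩
      refine ⟨⟨fun i => ⟨(h i).1, (h i).2.trans N.le_succ⟩, hf⟩, ?_⟩
      have := h (Fin.last n)
      omega
  · rw [Finset.mul_sum]
    refine Finset.sum_nbij' (fun f => Fin.init f) (fun f => Fin.snoc f (N + 1)) ?_ ?_ ?_ ?_ ?_
    · intro f hf
      simp only [Finset.mem_filter, Fintype.mem_piFinset, Finset.mem_Icc] at hf ⊢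
      obtain ⟨⟨h, hf⟩, hl⟩ := hf
      refine ⟨fun i => ⟨(h _).1, ?_⟩, hf.comp Fin.strictMono_castSucc⟩
      have := hf (Fin.castSucc_lt_last i)
      simp only [Fin.init]
      omega
    · intro f hf
      simp only [Finset.mem_filter, Fintype.mem_piFinset, Finset.mem_Icc] at hf ⊢
      refine ⟨⟨fun i => ?_, (strictMono_snoc_iff _ _).2 ⟨hf.2, fun i => ?_⟩⟩, by simp⟩
      · induction i using Fin.lastCases with
        | last => simp
        | cast i =>
          have := hf.1 i
          simp only [Fin.snoc_castSucc]
          omega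
      · have := hf.1 i
        omega
    · intro f hf
      rw [← (Finset.mem_filter.1 hf).2, Fin.snoc_init_self]
    · intro f _
      exact Fin.init_snoc _ _
    · intro f hf
      rw [Fin.prod_univ_castSucc, (Finset.mem_filter.1 hf).2, mul_comm]
      rfl

lemma monotoneSum_succ_succ (x : ℕ → ℝ) (N n : ℕ) :
    monotoneSum x (N + 1) (n + 1) =
      monotoneSum x N (n + 1) + x (N + 1) * monotoneSum x (N + 1) n := by
  unfold monotoneSum
  rw [← Finset.sum_filter_add_sum_filter_not _ (fun f => f (Fin.last n) = N + 1), add_comm]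
  congr 1
  · refine Finset.sum_congr ?_ fun _ _ => rfl
    ext f
    simp only [Finset.mem_filter, Fintype.mem_piFinset, Finset.mem_Icc]
    constructor
    · rintro ⟨⟨h, hf⟩, hl⟩
      refine ⟨fun i => ⟨(h i).1, ?_⟩, hf⟩
      have := hf (Fin.le_last i)
      have := h (Fin.last n)
      omega
    · rintro ⟨h, hf⟩
      refine ⟨⟨fun i => ⟨(h i).1, (h i).2.trans N.le_succ⟩, hf⟩, ?_⟩
      have := h (Fin.last n)
      omega
  · rw [Finset.mul_sum]
    refine Finset.sum_nbij' (fun f => Fin.init f) (fun f => Fin.snoc f (N + 1)) ?_ ?_ ?_ ?_ ?_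
    · intro f hf
      simp only [Finset.mem_filter, Fintype.mem_piFinset, Finset.mem_Icc] at hf ⊢
      exact ⟨fun i => hf.1.1 _, hf.1.2.comp Fin.strictMono_castSucc.monotone⟩
    · intro f hf
      simp only [Finset.mem_filter, Fintype.mem_piFinset, Finset.mem_Icc] at hf ⊢
      refine ⟨⟨fun i => ?_, (monotone_snoc_iff _ _).2 ⟨hf.2, fun i => (hf.1 i).2⟩⟩, by simp⟩
      induction i using Fin.lastCases with
      | last => simp
      | cast i => simpa only [Fin.snoc_castSucc] using hf.1 i
    · intro f hf
      rw [← (Finset.mem_filter.1 hf).2, Fin.snoc_init_self]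
    · intro f _
      exact Fin.init_snoc _ _
    · intro f hf
      rw [Fin.prod_univ_castSucc, (Finset.mem_filter.1 hf).2, mul_comm]
      rfl

open PowerSeries in
lemma mk_strictMonoSum_succ (x : ℕ → ℝ) (N : ℕ) :
    PowerSeries.mk (strictMonoSum x (N + 1)) =
      PowerSeries.mk (strictMonoSum x N) * (1 + C (x (N + 1)) * X) := by
  ext n
  rw [mul_add, mul_one, mul_left_comm, ← mul_assoc, map_add]
  cases n with
  | zero => simp [strictMonoSum_zero_right]
  | succ n => rw [coeff_succ_mul_X, coeff_C_mul]; simp [strictMonoSum_succ_succ]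

open PowerSeries in
lemma mk_monotoneSum_succ (x : ℕ → ℝ) (N : ℕ) :
    PowerSeries.mk (monotoneSum x (N + 1)) * (1 - C (x (N + 1)) * X) =
      PowerSeries.mk (monotoneSum x N) := by
  ext n
  rw [mul_sub, mul_one, mul_left_comm, ← mul_assoc, map_sub]
  cases n with
  | zero => simp [monotoneSum_zero_right]
  | succ n => rw [coeff_succ_mul_X, coeff_C_mul]; simp [monotoneSum_succ_succ]

open PowerSeries in
lemma mk_geometric_mul (y : ℝ) :
    PowerSeries.mk (fun k => y ^ (k + 1)) * (1 - C y * X) = C y := by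
  ext n
  rw [mul_sub, mul_one, mul_left_comm, ← mul_assoc, map_sub]
  cases n with
  | zero => simp
  | succ n => rw [coeff_succ_mul_X, coeff_C_mul]; simp [pow_succ']

open PowerSeries in
lemma derivative_mk_strictMonoSum (x : ℕ → ℝ) (N : ℕ) :
    d⁄dX ℝ (PowerSeries.mk (strictMonoSum x N)) =
      PowerSeries.mk (fun k => (-1) ^ k * ∑ j ∈ Finset.range N, x (j + 1) ^ (k + 1)) *
        PowerSeries.mk (strictMonoSum x N) := by
  induction N with
  | zero =>
    ext n
    have h : PowerSeries.mk (fun _ : ℕ => (0 : ℝ)) = 0 := by ext; simp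
    simp [coeff_derivative, strictMonoSum_zero_succ, h]
  | succ N ih =>
    have hsplit : PowerSeries.mk (fun k => (-1 : ℝ) ^ k *
          ∑ j ∈ Finset.range (N + 1), x (j + 1) ^ (k + 1)) =
        PowerSeries.mk (fun k => (-1) ^ k * ∑ j ∈ Finset.range N, x (j + 1) ^ (k + 1)) -
          PowerSeries.mk (fun k => (-x (N + 1)) ^ (k + 1)) := by
      ext k
      simp only [map_sub, coeff_mk, Finset.sum_range_succ]
      rw [neg_pow (x (N + 1))]
      ring
    have hg := mk_geometric_mul (-x (N + 1))
    rw [map_neg, neg_mul, sub_neg_eq_add] at hg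
    rw [mk_strictMonoSum_succ, Derivation.leibniz, ih, hsplit, map_add, Derivation.leibniz,
      derivative_C, derivative_X]
    simp only [smul_eq_mul, Derivation.map_one_eq_zero]
    linear_combination (PowerSeries.mk (strictMonoSum x N)) * hg

open PowerSeries in
lemma derivative_mk_monotoneSum (x : ℕ → ℝ) (N : ℕ) :
    d⁄dX ℝ (PowerSeries.mk (monotoneSum x N)) =
      PowerSeries.mk (fun k => ∑ j ∈ Finset.range N, x (j + 1) ^ (k + 1)) *
        PowerSeries.mk (monotoneSum x N) := by
  induction N with
  | zero =>
    ext n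
    have h : PowerSeries.mk (fun _ : ℕ => (0 : ℝ)) = 0 := by ext; simp
    simp [coeff_derivative, monotoneSum_zero_succ, h]
  | succ N ih =>
    have hsplit : PowerSeries.mk (fun k => ∑ j ∈ Finset.range (N + 1), x (j + 1) ^ (k + 1)) =
        PowerSeries.mk (fun k => ∑ j ∈ Finset.range N, x (j + 1) ^ (k + 1)) +
          PowerSeries.mk (fun k => x (N + 1) ^ (k + 1)) := by
      ext k
      simp [Finset.sum_range_succ]
    have hg := mk_geometric_mul (x (N + 1))
    have hne : (1 - C (x (N + 1)) * X : PowerSeries ℝ) ≠ 0 := by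
      intro h
      simpa using congrArg constantCoeff h
    rw [← mk_monotoneSum_succ, Derivation.leibniz, map_sub, Derivation.leibniz,
      derivative_C, derivative_X] at ih
    simp only [smul_eq_mul, Derivation.map_one_eq_zero] at ih
    apply mul_right_cancel₀ hne
    rw [hsplit]
    linear_combination ih - (PowerSeries.mk (monotoneSum x (N + 1))) * hg

lemma succ_mul_strictMonoSum (x : ℕ → ℝ) (N n : ℕ) :
    ((n : ℝ) + 1) * strictMonoSum x N (n + 1) =
      ∑ k ∈ Finset.range (n + 1), ((-1) ^ k * ∑ j ∈ Finset.range N, x (j + 1) ^ (k + 1)) *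
        strictMonoSum x N (n - k) := by
  have h := congrArg (PowerSeries.coeff n) (derivative_mk_strictMonoSum x N)
  rw [PowerSeries.coeff_derivative, PowerSeries.coeff_mul,
    Finset.Nat.sum_antidiagonal_eq_sum_range_succ_mk] at h
  simpa [mul_comm] using h

lemma succ_mul_monotoneSum (x : ℕ → ℝ) (N n : ℕ) :
    ((n : ℝ) + 1) * monotoneSum x N (n + 1) =
      ∑ k ∈ Finset.range (n + 1), (∑ j ∈ Finset.range N, x (j + 1) ^ (k + 1)) *
        monotoneSum x N (n - k) := by
  have h := congrArg (PowerSeries.coeff n) (derivative_mk_monotoneSum x N)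
  rw [PowerSeries.coeff_derivative, PowerSeries.coeff_mul,
    Finset.Nat.sum_antidiagonal_eq_sum_range_succ_mk] at h
  simpa [mul_comm] using h

/-- For `n ≤ M`, the coefficient of `t ^ n` in `exp (∑ i < M, c i * t ^ (i + 1))`. -/
noncomputable def weightedPartitionSum (c : ℕ → ℝ) (M n : ℕ) : ℝ :=
  ∑ a ∈ (Fintype.piFinset (fun _ : Fin M => Finset.range (M + 1))).filter
      (fun a => ∑ i : Fin M, ((i : ℕ) + 1) * a i = n),
    ∏ i : Fin M, (1 / (Nat.factorial (a i) : ℝ)) * c i ^ (a i)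

lemma weightedPartitionSum_zero (c : ℕ → ℝ) (M : ℕ) : weightedPartitionSum c M 0 = 1 := by
  have h : (Fintype.piFinset (fun _ : Fin M => Finset.range (M + 1))).filter
      (fun a => ∑ i : Fin M, ((i : ℕ) + 1) * a i = 0) = {0} := by
    ext a
    simp only [Finset.mem_filter, Fintype.mem_piFinset, Finset.mem_singleton, funext_iff]
    constructor
    · rintro ⟨-, h⟩ i
      simpa using Finset.sum_eq_zero_iff.1 h i (Finset.mem_univ i)
    · intro h
      simp [h]
  rw [weightedPartitionSum, h]
  simp

lemma sum_apply_mul_prod_eq (c : ℕ → ℝ) {M n : ℕ} (hn : n ≤ M) (i : Fin M) :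
    ∑ a ∈ (Fintype.piFinset (fun _ : Fin M => Finset.range (M + 1))).filter
        (fun a => ∑ i : Fin M, ((i : ℕ) + 1) * a i = n),
      (a i : ℝ) * ∏ i : Fin M, (1 / (Nat.factorial (a i) : ℝ)) * c i ^ (a i) =
    if (i : ℕ) < n then c i * weightedPartitionSum c M (n - (i + 1)) else 0 := by
  have hsum (a : Fin M → ℕ) : ∑ j : Fin M, ((j : ℕ) + 1) * (a + Pi.single i 1 : Fin M → ℕ) j =
      ∑ j : Fin M, ((j : ℕ) + 1) * a j + (i + 1) := by
    simp [mul_add, Finset.sum_add_distrib, Pi.single_apply]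
  have hle (a : Fin M → ℕ) (j : Fin M) : (j + 1) * a j ≤ ∑ j : Fin M, ((j : ℕ) + 1) * a j :=
    Finset.single_le_sum (f := fun j : Fin M => ((j : ℕ) + 1) * a j) (fun _ _ => Nat.zero_le _)
      (Finset.mem_univ j)
  have hsub (a : Fin M → ℕ) (h : a i ≠ 0) : a - Pi.single i 1 + Pi.single i 1 = a := by
    ext j
    by_cases hj : j = i
    · subst hj; simp; omega
    · simp [hj]
  split_ifs with hi
  · rw [weightedPartitionSum, Finset.mul_sum]
    rw [← Finset.sum_filter_of_ne (p := fun a => a i ≠ 0)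
      (fun a _ h h0 => h (by rw [h0, Nat.cast_zero, zero_mul]))]
    refine Finset.sum_nbij' (fun a => a - Pi.single i 1) (fun a => a + Pi.single i 1) ?_ ?_ ?_ ?_ ?_
    · intro a ha
      simp only [Finset.mem_filter, Fintype.mem_piFinset, Finset.mem_range] at ha ⊢
      have hs := hsum (a - Pi.single i 1)
      rw [hsub a ha.2, ha.1.2] at hs
      exact ⟨fun j => lt_of_le_of_lt (Nat.sub_le _ _) (ha.1.1 j), by omega⟩
    · intro a ha
      simp only [Finset.mem_filter, Fintype.mem_piFinset, Finset.mem_range] at ha ⊢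
      have hs : ∑ j : Fin M, ((j : ℕ) + 1) * (a + Pi.single i 1 : Fin M → ℕ) j = n := by
        rw [hsum, ha.2]; omega
      refine ⟨⟨fun j => ?_, hs⟩, by simp⟩
      have := hle (a + Pi.single i 1 : Fin M → ℕ) j
      nlinarith
    · intro a ha
      exact hsub a (Finset.mem_filter.1 ha).2
    · intro a _
      exact add_tsub_cancel_right _ _
    · intro a ha
      obtain ⟨d, rfl⟩ : ∃ d : Fin M → ℕ, a = d + Pi.single i 1 := ⟨_, (hsub a (Finset.mem_filter.1 ha).2).symm⟩
      rw [add_tsub_cancel_right, Fintype.prod_eq_mul_prod_compl i,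
        Fintype.prod_eq_mul_prod_compl i (fun j => 1 / ((d j).factorial : ℝ) * c j ^ d j)]
      have hrest : ∏ j ∈ {i}ᶜ, 1 / (((d + Pi.single i 1 : Fin M → ℕ) j).factorial : ℝ) *
          c j ^ (d + Pi.single i 1 : Fin M → ℕ) j = ∏ j ∈ {i}ᶜ, 1 / ((d j).factorial : ℝ) * c j ^ d j := by
        refine Finset.prod_congr rfl fun j hj => ?_
        have hji : j ≠ i := by simpa using hj
        simp [hji]
      rw [hrest]
      simp only [Pi.add_apply, Pi.single_eq_same, Nat.factorial_succ, pow_succ, Nat.cast_mul]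
      have : ((d i + 1 : ℕ) : ℝ) ≠ 0 := by positivity
      field_simp
  · refine Finset.sum_eq_zero fun a ha => ?_
    have := hle a i
    rw [(Finset.mem_filter.1 ha).2] at this
    have h0 : a i = 0 := by
      by_contra h
      have : 1 ≤ a i := Nat.one_le_iff_ne_zero.2 h
      nlinarith
    simp [h0]

lemma succ_mul_weightedPartitionSum (c : ℕ → ℝ) {M n : ℕ} (hn : n + 1 ≤ M) :
    ((n : ℝ) + 1) * weightedPartitionSum c M (n + 1) =
      ∑ k ∈ Finset.range (n + 1), (((k : ℝ) + 1) * c k) * weightedPartitionSum c M (n - k) := by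
  have h : ((n : ℝ) + 1) * weightedPartitionSum c M (n + 1) =
      ∑ i : Fin M, ((i : ℝ) + 1) *
        (if (i : ℕ) < n + 1 then c i * weightedPartitionSum c M (n + 1 - (i + 1)) else 0) := by
    simp_rw [← sum_apply_mul_prod_eq c hn, Finset.mul_sum]
    rw [Finset.sum_comm, weightedPartitionSum, Finset.mul_sum]
    refine Finset.sum_congr rfl fun a ha => ?_
    simp_rw [← mul_assoc]
    rw [← Finset.sum_mul]
    congr 1
    exact_mod_cast (Finset.mem_filter.1 ha).2.symm
  rw [h, Fin.sum_univ_eq_sum_range (fun k : ℕ => ((k : ℝ) + 1) *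
    (if k < n + 1 then c k * weightedPartitionSum c M (n + 1 - (k + 1)) else 0)) M]
  rw [← Finset.sum_subset (Finset.range_mono hn)]
  · refine Finset.sum_congr rfl fun k hk => ?_
    rw [if_pos (Finset.mem_range.1 hk), Nat.add_sub_add_right, mul_assoc]
  · intro k _ hk
    rw [if_neg (by simpa using hk), mul_zero]

lemma weightedPartitionSum_pow_mul (c : ℕ → ℝ) (q : ℝ) (M n : ℕ) :
    weightedPartitionSum (fun i => q ^ (i + 1) * c i) M n = q ^ n * weightedPartitionSum c M n := by
  unfold weightedPartitionSum
  rw [Finset.mul_sum]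
  refine Finset.sum_congr rfl fun a ha => ?_
  rw [← (Finset.mem_filter.1 ha).2, ← Finset.prod_pow_eq_pow_sum, ← Finset.prod_mul_distrib]
  refine Finset.prod_congr rfl fun i _ => ?_
  rw [mul_pow, pow_mul]
  ring

/-- The recurrence `(n + 1) u (n + 1) = ∑ k ≤ n, L k * u (n - k)` passes to the limit. -/
lemma tendsto_weightedPartitionSum {u L : ℕ → ℕ → ℝ} {c : ℕ → ℝ} (h0 : ∀ N, u N 0 = 1)
    (hu : ∀ N n : ℕ, ((n : ℝ) + 1) * u N (n + 1) =
      ∑ k ∈ Finset.range (n + 1), L N k * u N (n - k))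
    (hL : ∀ k, Tendsto (fun N => L N k) atTop (𝓝 (((k : ℝ) + 1) * c k)))
    {M n : ℕ} (hn : n ≤ M) :
    Tendsto (fun N => u N n) atTop (𝓝 (weightedPartitionSum c M n)) := by
  induction n using Nat.strong_induction_on with
  | _ n ih =>
    cases n with
    | zero => simp [h0, weightedPartitionSum_zero]
    | succ n =>
      have hpos : (n : ℝ) + 1 ≠ 0 := by positivity
      have key : Tendsto (fun N => ((n : ℝ) + 1) * u N (n + 1)) atTop
          (𝓝 (((n : ℝ) + 1) * weightedPartitionSum c M (n + 1))) := by
        rw [succ_mul_weightedPartitionSum c hn]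
        simp_rw [hu]
        exact tendsto_finsetSum _ fun k _ => (hL k).mul (ih (n - k) (by omega) (by omega))
      simpa [hpos] using key.const_mul ((n : ℝ) + 1)⁻¹

lemma tsum_subtype_eq_of_tendsto_sum {α : Type*} {p : α → Prop} {g : α → ℝ} (hg : ∀ a, 0 ≤ g a)
    {A : ℕ → Finset α} (hA : Monotone A) (hp : ∀ a, p a ↔ ∃ N, a ∈ A N) {l : ℝ}
    (hl : Tendsto (fun N => ∑ a ∈ A N, g a) atTop (𝓝 l)) :
    ∑' a : {a // p a}, g a = l := by
  classical
  have hB (N : ℕ) : ∑ a ∈ (A N).subtype p, g a = ∑ a ∈ A N, g a :=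
    Finset.sum_subtype_of_mem g fun a ha => (hp a).2 ⟨N, ha⟩
  have hmono : Monotone fun N => (A N).subtype p := fun _ _ h => Finset.subtype_mono (hA h)
  have htop : Tendsto (fun N => (A N).subtype p) atTop atTop :=
    tendsto_atTop_finset_of_monotone hmono fun a => by
      simpa using (hp a).1 a.2
  have hle (N : ℕ) : ∑ a ∈ A N, g a ≤ l :=
    Monotone.ge_of_tendsto (fun _ _ h => Finset.sum_le_sum_of_subset_of_nonneg (hA h)
      fun a _ _ => hg a) hl N
  have hsum : Summable fun a : {a // p a} => g a := by
    refine summable_of_sum_le (c := l) (fun a => hg a) fun s => ?_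
    obtain ⟨N, hN⟩ := (htop.eventually_ge_atTop s).exists
    exact (Finset.sum_le_sum_of_subset_of_nonneg hN fun a _ _ => hg a).trans
      ((hB N).trans_le (hle N))
  refine tendsto_nhds_unique (hsum.hasSum.comp htop) ?_
  simpa only [Function.comp_def, hB] using hl

lemma mzv_const_eq_of_tendsto {s l : ℝ} {n : ℕ}
    (h : Tendsto (fun N => strictMonoSum (fun j => (j : ℝ) ^ (-s)) N n) atTop (𝓝 l)) :
    mzv (fun _ : Fin n => s) = l := by
  refine tsum_subtype_eq_of_tendsto_sum (fun f : Fin n → ℕ => by positivity) ?_ ?_ h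
  · intro N N' hN
    exact Finset.filter_subset_filter _
      (Fintype.piFinset_subset _ _ fun _ => Finset.Icc_subset_Icc_right hN)
  · intro f
    simp only [Finset.mem_filter, Fintype.mem_piFinset, Finset.mem_Icc]
    exact ⟨fun hf => ⟨∑ i, f i, fun i => ⟨hf.1 i, Finset.single_le_sum
      (fun _ _ => Nat.zero_le _) (Finset.mem_univ i)⟩, hf.2⟩,
      fun ⟨_, hf⟩ => ⟨fun i => (hf.1 i).1, hf.2⟩⟩

lemma mzsv_const_eq_of_tendsto {s l : ℝ} {n : ℕ}
    (h : Tendsto (fun N => monotoneSum (fun j => (j : ℝ) ^ (-s)) N n) atTop (𝓝 l)) :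
    mzsv (fun _ : Fin n => s) = l := by
  refine tsum_subtype_eq_of_tendsto_sum (fun f : Fin n → ℕ => by positivity) ?_ ?_ h
  · intro N N' hN
    exact Finset.filter_subset_filter _
      (Fintype.piFinset_subset _ _ fun _ => Finset.Icc_subset_Icc_right hN)
  · intro f
    simp only [Finset.mem_filter, Fintype.mem_piFinset, Finset.mem_Icc]
    exact ⟨fun hf => ⟨∑ i, f i, fun i => ⟨hf.1 i, Finset.single_le_sum
      (fun _ _ => Nat.zero_le _) (Finset.mem_univ i)⟩, hf.2⟩,
      fun ⟨_, hf⟩ => ⟨fun i => (hf.1 i).1, hf.2⟩⟩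

lemma tendsto_sum_range_rpow_neg_pow {m : ℕ} (hm : 1 ≤ m) (k : ℕ) :
    Tendsto (fun N => ∑ j ∈ Finset.range N,
        (((j + 1 : ℕ) : ℝ) ^ (-((2 * m : ℕ) : ℝ))) ^ (k + 1)) atTop
      (𝓝 ((-1) ^ ((k + 1) * m + 1) * (2 * π) ^ (2 * m * (k + 1)) * (((k : ℝ) + 1) *
        (((bernoulli (2 * (k + 1) * m) : ℚ) : ℝ) /
          (2 * ((k : ℝ) + 1) * (Nat.factorial (2 * (k + 1) * m))))))) := by
  have hk : (k + 1) * m ≠ 0 := by positivity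
  have h := (hasSum_zeta_nat hk).tendsto_sum_nat.comp (tendsto_add_atTop_nat 1)
  convert h using 2 with N
  · simp only [Function.comp_def, Finset.sum_range_succ']
    rw [Nat.cast_zero, zero_pow (by positivity), div_zero, add_zero]
    refine Finset.sum_congr rfl fun j _ => ?_
    rw [Real.rpow_neg (by positivity), Real.rpow_natCast, inv_pow, ← pow_mul, one_div]
    congr 2
    ring
  · have h2 : (2 : ℝ) ^ (2 * ((k + 1) * m)) = 2 ^ (2 * ((k + 1) * m) - 1) * 2 := by
      rw [← pow_succ]; congr 1; omega
    have e1 : 2 * m * (k + 1) = 2 * ((k + 1) * m) := by ring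
    have e2 : 2 * (k + 1) * m = 2 * ((k + 1) * m) := by ring
    have hk' : (k : ℝ) + 1 ≠ 0 := by positivity
    rw [e1, e2, mul_pow, h2]
    field_simp

/-- For positive `m`, `n`:
`ζ({2m}^n) = (-1)^{n(m+1)} (2π)^{2mn} Σ_{a₁+2a₂+⋯+na_n=n} Π_k (1/a_k!) (B_{2km}/(2k(2km)!))^{a_k}`
and
`ζ⋆({2m}^n) = (-1)^{mn} (2π)^{2mn} Σ_{a₁+2a₂+⋯+na_n=n} Π_k ((-1)^{a_k}/a_k!) (B_{2km}/(2k(2km)!))^{a_k}`. -/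
theorem zeta_and_star_two_m_bernoulli (m n : ℕ) (hm : 1 ≤ m) (hn : 1 ≤ n) :
    mzv (fun _ : Fin n => ((2 * m : ℕ) : ℝ)) =
      (-1 : ℝ) ^ (n * (m + 1)) * (2 * π) ^ (2 * m * n) *
        ∑ a ∈ (Fintype.piFinset (fun _ : Fin n => Finset.range (n + 1))).filter
            (fun a => ∑ i : Fin n, ((i : ℕ) + 1) * a i = n),
          ∏ i : Fin n,
            (1 / (Nat.factorial (a i) : ℝ)) *
              (((bernoulli (2 * ((i : ℕ) + 1) * m) : ℚ) : ℝ) /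
                (2 * ((i : ℕ) + 1) * (Nat.factorial (2 * ((i : ℕ) + 1) * m)))) ^ (a i) ∧
    mzsv (fun _ : Fin n => ((2 * m : ℕ) : ℝ)) =
      (-1 : ℝ) ^ (m * n) * (2 * π) ^ (2 * m * n) *
        ∑ a ∈ (Fintype.piFinset (fun _ : Fin n => Finset.range (n + 1))).filter
            (fun a => ∑ i : Fin n, ((i : ℕ) + 1) * a i = n),
          ∏ i : Fin n,
            ((-1 : ℝ) ^ (a i) / (Nat.factorial (a i) : ℝ)) *
              (((bernoulli (2 * ((i : ℕ) + 1) * m) : ℚ) : ℝ) /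
                (2 * ((i : ℕ) + 1) * (Nat.factorial (2 * ((i : ℕ) + 1) * m)))) ^ (a i) := by
  set b : ℕ → ℝ := fun i => ((bernoulli (2 * (i + 1) * m) : ℚ) : ℝ) /
    (2 * ((i : ℝ) + 1) * (Nat.factorial (2 * (i + 1) * m))) with hb
  have hlim := tendsto_sum_range_rpow_neg_pow hm
  constructor
  · have h := mzv_const_eq_of_tendsto (s := (2 * m : ℕ)) (tendsto_weightedPartitionSum
      (c := fun i => ((-1) ^ (m + 1) * (2 * π) ^ (2 * m)) ^ (i + 1) * b i)
      (strictMonoSum_zero_right _) (succ_mul_strictMonoSum _)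
      (fun k => ?_) le_rfl (n := n))
    · rw [h, weightedPartitionSum_pow_mul, mul_pow, ← pow_mul, ← pow_mul, mul_comm (m + 1)]
      rfl
    · convert (hlim k).const_mul ((-1) ^ k) using 2
      simp only [hb]
      ring
  · have h := mzsv_const_eq_of_tendsto (s := (2 * m : ℕ)) (tendsto_weightedPartitionSum
      (c := fun i => ((-1) ^ m * (2 * π) ^ (2 * m)) ^ (i + 1) * (-b i))
      (monotoneSum_zero_right _) (succ_mul_monotoneSum _)
      (fun k => ?_) le_rfl (n := n))
    · rw [h, weightedPartitionSum_pow_mul, mul_pow, ← pow_mul, ← pow_mul]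
      congr 1
      refine Finset.sum_congr rfl fun a _ => Finset.prod_congr rfl fun i _ => ?_
      rw [neg_pow (b i)]
      simp only [hb]
      ring
    · convert hlim k using 2
      simp only [hb]
      ring
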